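/- Fix n ∈ ℕ and let P[n] denote the real vector space of polynomials in two variables z₁, z₂ of total degree at most n. Define L : P[n] → ℝ[z₁, z₂] by L(g) = Δ((1 − z₁² − z₂²)·g). Then L maps P[n] into P[n], and L : P[n] → P[n] is a linear bijection; in particular, for every f ∈ P[n] there exists a unique g ∈ P[n] with Δ((1 − z₁² − z₂²)·g) = f. -/

import Mathlib

open MvPolynomial

noncomputable section

/-- The formal Laplacian `Δp = ∂²p/∂z₁² + ∂²p/∂z₂²` of a polynomial in two variables. -/
def plap (p : MvPolynomial (Fin 2) ℝ) : MvPolynomial (Fin 2) ℝ :=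
  pderiv 0 (pderiv 0 p) + pderiv 1 (pderiv 1 p)

namespace MvPolynomial

variable {σ : Type*}

/-- The Fischer inner product on real polynomials, in which the monomials `X ^ a` are orthogonal
with squared norm `∏ i, (a i)!`. -/
def fischer : MvPolynomial σ ℝ →ₗ[ℝ] MvPolynomial σ ℝ →ₗ[ℝ] ℝ :=
  (basisMonomials σ ℝ).constr ℝ fun a => (a.prod fun _ k => (k.factorial : ℝ)) • lcoeff ℝ a

theorem fischer_monomial (a : σ →₀ ℕ) (c : ℝ) (q : MvPolynomial σ ℝ) :
    fischer (monomial a c) q = c * ((a.prod fun _ k => (k.factorial : ℝ)) * coeff a q) := by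
  have h : monomial a c = c • basisMonomials σ ℝ a := by
    simp [coe_basisMonomials, smul_monomial]
  rw [h, map_smul, fischer, Module.Basis.constr_basis]
  simp

theorem fischer_eq_sum (p q : MvPolynomial σ ℝ) :
    fischer p q = ∑ a ∈ p.support,
      coeff a p * ((a.prod fun _ k => (k.factorial : ℝ)) * coeff a q) := by
  conv_lhs => rw [p.as_sum]
  simp only [map_sum, LinearMap.sum_apply, fischer_monomial]

theorem prod_factorial_add_single (a : σ →₀ ℕ) (i : σ) :
    ((a + Finsupp.single i 1).prod fun _ k => (k.factorial : ℝ)) =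
      (a i + 1) * a.prod fun _ k => (k.factorial : ℝ) := by
  classical
  have h0 : ∀ j : σ, (fun (_ : σ) (k : ℕ) => (k.factorial : ℝ)) j 0 = 1 := by simp
  rw [← Finsupp.mul_prod_erase' (a + Finsupp.single i 1) i _ (fun j => h0 j),
    ← Finsupp.mul_prod_erase' a i _ (fun j => h0 j), Finsupp.erase_add, Finsupp.erase_single,
    add_zero]
  simp [Nat.factorial_succ, mul_assoc]

theorem fischer_X_mul (i : σ) (p q : MvPolynomial σ ℝ) :
    fischer (X i * p) q = fischer p (pderiv i q) := by
  induction p using MvPolynomial.induction_on' with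
  | monomial a c =>
    rw [X, monomial_mul, one_mul, add_comm, fischer_monomial, fischer_monomial, coeff_pderiv,
      prod_factorial_add_single]
    ring
  | add p₁ p₂ h₁ h₂ => simp only [mul_add, map_add, LinearMap.add_apply, h₁, h₂]

theorem prod_factorial_pos (a : σ →₀ ℕ) : 0 < a.prod fun _ k => (k.factorial : ℝ) :=
  Finset.prod_pos fun i _ => by positivity

theorem eq_zero_of_fischer_eq_zero {p q : MvPolynomial σ ℝ}
    (hpq : ∀ a ∈ p.support, coeff a q = -coeff a p) (h : fischer p q = 0) : p = 0 := by
  rw [fischer_eq_sum, Finset.sum_eq_zero_iff_of_nonpos] at h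
  · rw [← support_eq_empty, Finset.eq_empty_iff_forall_notMem]
    intro a ha
    have := h a ha
    rw [hpq a ha] at this
    have hc := mem_support_iff.mp ha
    simp [hc, (prod_factorial_pos a).ne'] at this
  · intro a ha
    rw [hpq a ha]
    nlinarith [mul_nonneg (prod_factorial_pos a).le (sq_nonneg (coeff a p))]

theorem coeff_X_sq_mul_homogeneousComponent {R : Type*} [CommSemiring R] (i : σ) {m : ℕ}
    {a : σ →₀ ℕ} (ha : a.degree = m + 2) (p : MvPolynomial σ R) :
    coeff a (X i ^ 2 * homogeneousComponent m p) = coeff a (X i ^ 2 * p) := by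
  rw [X_pow_eq_monomial, coeff_monomial_mul', coeff_monomial_mul']
  split_ifs with h
  · have hd : (a - Finsupp.single i 2).degree = m := by
      have := congrArg Finsupp.degree (tsub_add_cancel_of_le h)
      rw [map_add, Finsupp.degree_single] at this
      omega
    rw [coeff_homogeneousComponent, if_pos hd]
  · rfl

theorem totalDegree_pderiv_le {R : Type*} [CommSemiring R] (i : σ) {n : ℕ} {p : MvPolynomial σ R}
    (hp : p.totalDegree ≤ n + 1) : (pderiv i p).totalDegree ≤ n := by
  rw [totalDegree, Finset.sup_le_iff]
  intro a ha
  have hc : coeff (a + Finsupp.single i 1) p ≠ 0 := by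
    intro h0
    rw [mem_support_iff, coeff_pderiv, h0] at ha
    simp at ha
  have h1 : (a + Finsupp.single i 1).degree ≤ n + 1 :=
    (le_totalDegree (mem_support_iff.mpr hc)).trans hp
  rw [map_add, Finsupp.degree_single] at h1
  change a.degree ≤ n
  omega

end MvPolynomial

theorem fischer_plap (p q : MvPolynomial (Fin 2) ℝ) :
    fischer p (plap q) = fischer ((X 0 ^ 2 + X 1 ^ 2) * p) q := by
  simp only [plap, map_add, ← fischer_X_mul, add_mul, LinearMap.add_apply, pow_two, mul_assoc]

theorem eq_zero_of_plap_eq_zero {g : MvPolynomial (Fin 2) ℝ}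
    (hg : plap ((1 - X 0 ^ 2 - X 1 ^ 2) * g) = 0) : g = 0 := by
  by_contra hne
  set m := g.totalDegree with hm
  set h := homogeneousComponent m g with hh
  have hh0 : h ≠ 0 := by
    obtain ⟨a, ha, had⟩ := Finset.exists_mem_eq_sup g.support (support_nonempty.mpr hne)
      fun s => s.sum fun _ e => e
    have hdeg : a.degree = m := had.symm
    intro h0
    have := congrArg (coeff a) h0
    rw [hh, coeff_homogeneousComponent, if_pos hdeg, coeff_zero] at this
    exact mem_support_iff.mp ha this
  have hr : (X 0 ^ 2 + X 1 ^ 2 : MvPolynomial (Fin 2) ℝ) ≠ 0 := by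
    intro h0
    have := congrArg (eval fun _ => (1 : ℝ)) h0
    norm_num at this
  have hhom : ((X 0 ^ 2 + X 1 ^ 2) * h).IsHomogeneous (m + 2) := by
    rw [add_comm m]
    exact ((isHomogeneous_X_pow 0 2).add (isHomogeneous_X_pow 1 2)).mul
      (homogeneousComponent_isHomogeneous m g)
  refine mul_ne_zero hr hh0 (eq_zero_of_fischer_eq_zero
    (q := (1 - X 0 ^ 2 - X 1 ^ 2) * g) (fun a ha => ?_) ?_)
  · have had : a.degree = m + 2 := by
      by_contra hcon
      exact mem_support_iff.mp ha (hhom.coeff_eq_zero hcon)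
    have hg0 : coeff a g = 0 := by
      apply coeff_eq_zero_of_totalDegree_lt
      change m < a.degree
      omega
    simp only [sub_mul, add_mul, one_mul, coeff_sub, coeff_add, hg0, hh,
      coeff_X_sq_mul_homogeneousComponent _ had]
    ring
  · rw [← fischer_plap, hg, map_zero]

theorem totalDegree_plap_le {n : ℕ} {p : MvPolynomial (Fin 2) ℝ} (hp : p.totalDegree ≤ n + 2) :
    (plap p).totalDegree ≤ n :=
  (totalDegree_add _ _).trans <| max_le
    (totalDegree_pderiv_le 0 (totalDegree_pderiv_le 0 hp))
    (totalDegree_pderiv_le 1 (totalDegree_pderiv_le 1 hp))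

theorem totalDegree_disk_factor_le :
    (1 - X 0 ^ 2 - X 1 ^ 2 : MvPolynomial (Fin 2) ℝ).totalDegree ≤ 2 := by
  refine (totalDegree_sub _ _).trans (max_le ((totalDegree_sub _ _).trans (max_le ?_ ?_)) ?_) <;>
    simp

theorem totalDegree_plap_disk_factor_mul_le {n : ℕ} {g : MvPolynomial (Fin 2) ℝ}
    (hg : g.totalDegree ≤ n) : (plap ((1 - X 0 ^ 2 - X 1 ^ 2) * g)).totalDegree ≤ n := by
  apply totalDegree_plap_le
  have := totalDegree_mul (1 - X 0 ^ 2 - X 1 ^ 2) g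
  have := totalDegree_disk_factor_le
  omega

/-- The Laplacian of the product with `1 - z₁² - z₂²`, as a linear map. -/
def plapDiskFactor : MvPolynomial (Fin 2) ℝ →ₗ[ℝ] MvPolynomial (Fin 2) ℝ where
  toFun g := plap ((1 - X 0 ^ 2 - X 1 ^ 2) * g)
  map_add' g₁ g₂ := by
    simp only [plap, mul_add, map_add]
    ring
  map_smul' c g := by
    simp only [plap, mul_smul_comm, Derivation.map_smul, smul_add, RingHom.id_apply]

/-- The map `L(g) = Δ((1 − z₁² − z₂²)·g)` maps the space `P[n]` of polynomials
of total degree at most `n` into itself, and is a bijection of `P[n]`: for every `f ∈ P[n]`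
there is a unique `g ∈ P[n]` with `Δ((1 − z₁² − z₂²)·g) = f`. -/
theorem laplacian_disk_factor_bijective_on_degree_le
    (n : ℕ) :
    (∀ g : MvPolynomial (Fin 2) ℝ, g.totalDegree ≤ n →
      (plap ((1 - X 0 ^ 2 - X 1 ^ 2) * g)).totalDegree ≤ n) ∧
    (∀ f : MvPolynomial (Fin 2) ℝ, f.totalDegree ≤ n →
      ∃! g : MvPolynomial (Fin 2) ℝ,
        g.totalDegree ≤ n ∧ plap ((1 - X 0 ^ 2 - X 1 ^ 2) * g) = f) := by
  refine ⟨fun g hg => totalDegree_plap_disk_factor_mul_le hg, fun f hf => ?_⟩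
  have hinj : Function.Injective plapDiskFactor :=
    (injective_iff_map_eq_zero _).mpr fun g hg => eq_zero_of_plap_eq_zero hg
  have hmaps : ∀ g ∈ restrictTotalDegree (Fin 2) ℝ n,
      plapDiskFactor g ∈ restrictTotalDegree (Fin 2) ℝ n := by
    intro g hg
    rw [mem_restrictTotalDegree] at hg ⊢
    exact totalDegree_plap_disk_factor_mul_le hg
  have hsurj : Function.Surjective (plapDiskFactor.restrict hmaps) :=
    LinearMap.injective_iff_surjective.mp
      fun x y hxy => Subtype.ext (hinj (congrArg Subtype.val hxy))
  obtain ⟨g, hg⟩ := hsurj ⟨f, (mem_restrictTotalDegree _ _ _).mpr hf⟩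
  have hgf : plapDiskFactor g = f := congrArg Subtype.val hg
  exact ⟨g, ⟨(mem_restrictTotalDegree _ _ _).mp g.2, hgf⟩,
    fun g' hg' => hinj (hg'.2.trans hgf.symm)⟩

end
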